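/- Let G be a finite group and π an irreducible complex representation appearing in a representation γ whose character is Σ_i c_i R_i with R_i virtual characters and Σ_i |c_i| ≤ B. Let ω be a representation of G such that |⟨R_i ⊗ ω, R_j⟩_G| ≤ A for all i, j from two such decompositions (for π and π' with bounds B and B' respectively). Then dim Hom_G(π ⊗ ω, π') ≤ A·B·B'. In particular, with A = 4^n n! and B = B' = 2^n √(2^n n!), the bound is 2^{5n}(n!)^2. -/

import Mathlib

open CategoryTheory MonoidalCategory Module

/-- The standard inner product of class functions on a finite group:
`⟨f, g⟩ = (1/|G|) Σ_{x ∈ G} f(x) conj(g(x))`. -/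
noncomputable def classInner (G : Type) [Fintype G] (f g : G → ℂ) : ℂ :=
  (Fintype.card G : ℂ)⁻¹ * ∑ x : G, f x * starRingEnd ℂ (g x)

open scoped ComplexOrder in
/-- If `A` ranges over the image of a representation of a finite group by complex matrices, then
averaging the standard Hermitian form shows `tr A⁻¹` to be the complex conjugate of `tr A`. -/
theorem trace_map_inv_eq_conj {G n : Type*} [Group G] [Fintype G] [Fintype n] [DecidableEq n]
    (φ : G →* Matrix n n ℂ) (g : G) :
    (φ g⁻¹).trace = starRingEnd ℂ (φ g).trace := by
  set M : Matrix n n ℂ := ∑ h, (φ h).conjTranspose * φ h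
  have hM : IsUnit M := by
    classical
    refine Matrix.PosDef.isUnit ?_
    rw [show M = _ from (Finset.add_sum_erase _ _ (Finset.mem_univ (1 : G))).symm, map_one,
      Matrix.conjTranspose_one, mul_one]
    exact Matrix.PosDef.one.add_posSemidef
      (Matrix.posSemidef_sum _ fun h _ => Matrix.posSemidef_conjTranspose_mul_self (φ h))
  have hinv : M * φ g⁻¹ = (φ g).conjTranspose * M := by
    simp only [M, Finset.sum_mul, Finset.mul_sum]
    refine Fintype.sum_equiv (Equiv.mulRight g⁻¹) _ _ fun h => ?_
    simp only [Equiv.coe_mulRight, ← Matrix.mul_assoc, ← Matrix.conjTranspose_mul, ← map_mul,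
      inv_mul_cancel_right]
    rw [Matrix.mul_assoc, ← map_mul]
  obtain ⟨u, hu⟩ := hM
  have hconj : φ g⁻¹ = (↑u⁻¹ : Matrix n n ℂ) * ((φ g).conjTranspose * u) := by
    rw [hu, ← hinv, ← hu, Units.inv_mul_cancel_left]
  rw [hconj, Matrix.trace_mul_comm, Matrix.mul_assoc, Units.mul_inv, mul_one,
    Matrix.trace_conjTranspose]
  rfl

theorem FDRep.char_inv_eq_conj {G : Type} [Group G] [Fintype G] (V : FDRep ℂ G) (g : G) :
    V.character g⁻¹ = starRingEnd ℂ (V.character g) := by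
  let b := Module.finBasis ℂ V
  let φ : G →* Matrix _ _ ℂ := (MonoidHomClass.toMonoidHom (LinearMap.toMatrixAlgEquiv b)).comp V.ρ
  have h (x : G) : V.character x = (φ x).trace :=
    LinearMap.trace_eq_matrix_trace ℂ b (V.ρ x)
  rw [h, h, trace_map_inv_eq_conj]

theorem FDRep.finrank_hom_eq_classInner {G : Type} [Group G] [Fintype G] (V W : FDRep ℂ G) :
    (finrank ℂ (V ⟶ W) : ℂ) = classInner G V.character W.character := by
  have : Invertible (Nat.card G : ℂ) := invertibleOfNonzero (by simp)
  rw [← Complex.conj_natCast, ← FDRep.scalar_product_char_eq_finrank_equivariant, classInner]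
  simp [map_sum, FDRep.char_inv_eq_conj, mul_comm]

theorem FDRep.finrank_hom_tensor_le {G : Type} [Group G] [Fintype G]
    {V V' U U' : FDRep ℂ G} (W : FDRep ℂ G) (f : V ⟶ U) [Mono f] (f' : V' ⟶ U') [Mono f'] :
    finrank ℂ (V ⊗ W ⟶ V') ≤ finrank ℂ (U ⊗ W ⟶ U') := by
  have : NeZero (Nat.card G : ℂ) := ⟨by simp⟩
  let r : U ⟶ V := Injective.factorThru (𝟙 V) f
  have hr : f ≫ r = 𝟙 V := Injective.comp_factorThru (𝟙 V) f
  refine LinearMap.finrank_le_finrank_of_injective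
    (f := Linear.leftComp ℂ U' (r ▷ W) ∘ₗ Linear.rightComp ℂ (V ⊗ W) f') ?_
  refine Function.LeftInverse.injective (g := fun φ => f ▷ W ≫ φ) (f := fun φ => r ▷ W ≫ φ)
    (fun φ => ?_) |>.comp fun φ ψ h => (cancel_mono f').1 h
  dsimp only
  rw [← comp_whiskerRight_assoc, hr, id_whiskerRight, Category.id_comp]

theorem classInner_sum_smul_mul_sum_smul {G ι κ : Type} [Fintype G] (s : Finset ι) (t : Finset κ)
    (c : ι → ℂ) (d : κ → ℂ) (R : ι → G → ℂ) (R' : κ → G → ℂ) (w : G → ℂ) :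
    classInner G ((∑ i ∈ s, c i • R i) * w) (∑ j ∈ t, d j • R' j) =
      ∑ i ∈ s, ∑ j ∈ t, c i * starRingEnd ℂ (d j) * classInner G (R i * w) (R' j) := by
  simp only [classInner, Pi.mul_apply, Finset.sum_apply, Pi.smul_apply, smul_eq_mul, map_sum,
    map_mul, Finset.sum_mul, Finset.mul_sum]
  rw [Finset.sum_comm, Finset.sum_comm (s := s)]
  refine Finset.sum_congr rfl fun j _ => ?_
  rw [Finset.sum_comm]
  exact Finset.sum_congr rfl fun i _ => Finset.sum_congr rfl fun x _ => by ring

/-- Let `π, π'` be irreducible complex representations of a finite group `G`,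
subrepresentations of `γ, γ'` whose characters decompose as `Σ_i c_i R_i` and
`Σ_j d_j R'_j` with `Σ_i |c_i| ≤ B` and `Σ_j |d_j| ≤ B'`. If `ω` is a
representation with `|⟨R_i · χ_ω, R'_j⟩| ≤ A` for all `i, j`, then
`dim Hom_G(π ⊗ ω, π') ≤ A·B·B'`. (With `A = 4^n n!`, `B = B' = 2^n √(2^n n!)`,
this gives the bound `2^{5n}(n!)^2` of the main theorem.) -/
theorem hom_dim_le_A_mul_B_mul_B' (G : Type) [Group G] [Fintype G]
    (π π' γ γ' ω : FDRep ℂ G) (hπ : Simple π) (hπ' : Simple π')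
    (f : π ⟶ γ) (hf : Mono f) (f' : π' ⟶ γ') (hf' : Mono f')
    {ι κ : Type} (s : Finset ι) (t : Finset κ) (c : ι → ℂ) (d : κ → ℂ)
    (R : ι → G → ℂ) (R' : κ → G → ℂ)
    (hγ : γ.character = ∑ i ∈ s, c i • R i)
    (hγ' : γ'.character = ∑ j ∈ t, d j • R' j)
    (A B B' : ℝ) (hB : ∑ i ∈ s, ‖c i‖ ≤ B) (hB' : ∑ j ∈ t, ‖d j‖ ≤ B')
    (h0A : 0 ≤ A) (h0B : 0 ≤ B) (h0B' : 0 ≤ B')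
    (hA : ∀ i ∈ s, ∀ j ∈ t, ‖classInner G (R i * ω.character) (R' j)‖ ≤ A) :
    (finrank ℂ (π ⊗ ω ⟶ π') : ℝ) ≤ A * B * B' := by
  have hle := FDRep.finrank_hom_tensor_le ω f f'
  have hdim : (finrank ℂ (γ ⊗ ω ⟶ γ') : ℝ) =
      ‖classInner G ((∑ i ∈ s, c i • R i) * ω.character) (∑ j ∈ t, d j • R' j)‖ := by
    rw [← hγ, ← hγ', ← FDRep.char_tensor, ← FDRep.finrank_hom_eq_classInner, Complex.norm_natCast]
  calc (finrank ℂ (π ⊗ ω ⟶ π') : ℝ)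
      ≤ finrank ℂ (γ ⊗ ω ⟶ γ') := by exact_mod_cast hle
    _ ≤ ∑ i ∈ s, ∑ j ∈ t, ‖c i‖ * ‖d j‖ * A := by
      rw [hdim, classInner_sum_smul_mul_sum_smul]
      refine norm_sum_le_of_le _ fun i hi => norm_sum_le_of_le _ fun j hj => ?_
      rw [norm_mul, norm_mul, RCLike.norm_conj]
      gcongr
      exact hA i hi j hj
    _ = A * ((∑ i ∈ s, ‖c i‖) * ∑ j ∈ t, ‖d j‖) := by
      rw [Finset.sum_mul_sum, mul_comm]
      simp_rw [Finset.sum_mul]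
    _ ≤ A * B * B' := by
      rw [mul_assoc]
      gcongr
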